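/- arXiv:2504.09239 — 2 statements merged into one kernel-verified Lean document; each statement's English description precedes it below -/
import Mathlib

section
/- Let e ∈ L be a norm-lift and let A be a finite rank-1 ℤ_p[G]-module with invariants r ≥ 1, s ≥ 1 and t ∈ {0,…,p−1} (so that p^s·a = e^s·(g−1)^(s(p−1))·a + t·(g−1)^r·a for every generator a of A). Then for every surjective L-module homomorphism φ : L → A, the kernel of φ equals the L-submodule of L generated by (g−1)^(r+1) and p^s·1 − e^s·(g−1)^(s(p−1)) − t·(g−1)^r. -/
noncomputable section

/-- The group algebra `ℤ_p[G]` for `G` cyclic of order `p`. -/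
abbrev L (p : ℕ) [Fact p.Prime] : Type := MonoidAlgebra (PadicInt p) (Multiplicative (ZMod p))

/-- The fixed generator `g` of `G`, viewed inside `L = ℤ_p[G]`. -/
def gL (p : ℕ) [Fact p.Prime] : L p :=
  MonoidAlgebra.of (PadicInt p) (Multiplicative (ZMod p)) (Multiplicative.ofAdd 1)

/-- The norm element `N = 1 + g + ⋯ + g^(p-1)` of `L`. -/
def NL (p : ℕ) [Fact p.Prime] : L p := ∑ i ∈ Finset.range p, gL p ^ i


/-- `e ∈ L` is a norm-lift if `p·1 = e·(g−1)^(p−1) + α·N` for some `α ∈ ℤ_p`. -/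
def IsNormLift (p : ℕ) [Fact p.Prime] (e : L p) : Prop :=
  ∃ α : PadicInt p, (p : L p) = e * (gL p - 1) ^ (p - 1) + α • NL p

/-- The submodule `(g−1)A` of an `ℤ_p[G]`-module `A`. -/
def commSub (p : ℕ) [Fact p.Prime] (A : Type) [AddCommGroup A] [Module (L p) A] :
    Submodule (L p) A :=
  LinearMap.range (LinearMap.lsmul (L p) A (gL p - 1))

/-- The fixed-point submodule `A^G = {x ∈ A : g·x = x}` of an `ℤ_p[G]`-module `A`. -/
def fixedSub (p : ℕ) [Fact p.Prime] (A : Type) [AddCommGroup A] [Module (L p) A] :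
    Submodule (L p) A :=
  LinearMap.ker (LinearMap.lsmul (L p) A (gL p - 1))

/-- An `ℤ_p[G]`-module has rank 1 if it is nonzero and generated by a single element. -/
def IsRankOne (p : ℕ) [Fact p.Prime] (A : Type) [AddCommGroup A] [Module (L p) A] : Prop :=
  Nontrivial A ∧ ∃ a : A, Submodule.span (L p) {a} = ⊤

theorem aux_g_pow (p : ℕ) [Fact p.Prime] (n : ℕ) : gL p ^ n =
    MonoidAlgebra.of (PadicInt p) (Multiplicative (ZMod p)) (Multiplicative.ofAdd (n : ZMod p)) := by
  unfold gL
  rw [← map_pow, ← ofAdd_nsmul]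
  simp

theorem aux_g_p (p : ℕ) [Fact p.Prime] : gL p ^ p = 1 := by
  rw [aux_g_pow]; simp [MonoidAlgebra.one_def]

theorem aux_aug (p : ℕ) [Fact p.Prime] (l : L p) :
    ∃ (c : PadicInt p) (m : L p), l = algebraMap (PadicInt p) (L p) c + (gL p - 1) * m := by
  induction l using MonoidAlgebra.induction_on with
  | of h =>
    obtain ⟨d, hd⟩ := sub_dvd_pow_sub_pow (gL p) 1 (ZMod.val (Multiplicative.toAdd h))
    refine ⟨1, d, ?_⟩
    rw [← hd, aux_g_pow, one_pow]
    simp [MonoidAlgebra.one_def]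
  | add a b ha hb =>
    obtain ⟨c, m, rfl⟩ := ha
    obtain ⟨c', m', rfl⟩ := hb
    exact ⟨c + c', m + m', by rw [map_add]; ring⟩
  | smul k a ha =>
    obtain ⟨c, m, rfl⟩ := ha
    exact ⟨k * c, algebraMap _ _ k * m, by rw [Algebra.smul_def, map_mul]; ring⟩

theorem aux_px (p : ℕ) [Fact p.Prime] (e : L p) (he : IsNormLift p e) :
    (p : L p) * (gL p - 1) = e * (gL p - 1) ^ p := by
  obtain ⟨α, h⟩ := he
  have hp : p = (p - 1) + 1 := (Nat.succ_pred_prime Fact.out).symm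
  have hN : NL p * (gL p - 1) = 0 := by
    unfold NL
    rw [geom_sum_mul, aux_g_p, sub_self]
  have h2 : (gL p - 1) ^ p = (gL p - 1) ^ (p - 1) * (gL p - 1) := by
    rw [← pow_succ, ← hp]
  rw [h2, h, add_mul, smul_mul_assoc, hN, smul_zero, add_zero, mul_assoc]

theorem aux_xp (p : ℕ) [Fact p.Prime] : ∃ u : L p, (gL p - 1) ^ p = p * u := by
  obtain ⟨u, hu⟩ := exists_add_pow_prime_eq (Fact.out : p.Prime) (gL p - 1) 1
  rw [sub_add_cancel, aux_g_p, one_pow] at hu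
  refine ⟨-((gL p - 1) * u), ?_⟩
  linear_combination -hu

/-- remainder -/
theorem aux_div (p : ℕ) [Fact p.Prime] (n : ℕ) (c : PadicInt p) :
    ∃ k < p ^ n, ∃ d : PadicInt p, c = k + p ^ n * d := by
  refine ⟨c.appr n, c.appr_lt n, ?_⟩
  have := PadicInt.appr_spec n c
  rw [Ideal.mem_span_singleton] at this
  obtain ⟨d, hd⟩ := this
  exact ⟨d, by rw [← hd]; ring⟩

theorem aux_set (p : ℕ) [Fact p.Prime] (e : L p) (he : IsNormLift p e) (J : Submodule (L p) (L p))
    (s : ℕ) (v : L p) (hv : (p : L p) ^ s - (gL p - 1) * v ∈ J) (j : ℕ) :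
    ∃ S : Finset (L p), S.card ≤ p ^ (j + s) ∧
      ∀ l : L p, ∃ u ∈ S, ∃ m : L p, l - u - (gL p - 1) ^ (j + 1) * m ∈ J := by
  classical
  induction j with
  | zero =>
    refine ⟨(Finset.range (p ^ s)).image (fun n : ℕ => (n : L p)), ?_, ?_⟩
    · refine Finset.card_image_le.trans ?_
      simp
    · intro l
      obtain ⟨c, m, rfl⟩ := aux_aug p l
      obtain ⟨k, hk, d, rfl⟩ := aux_div p s c
      refine ⟨k, Finset.mem_image_of_mem _ (Finset.mem_range.2 hk), m + v * algebraMap _ _ d, ?_⟩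
      have := J.smul_mem (algebraMap (PadicInt p) (L p) d) hv
      convert this using 1
      simp only [map_add, map_mul, map_pow, map_natCast, smul_eq_mul]
      ring
  | succ j ih =>
    obtain ⟨S, hS, h⟩ := ih
    refine ⟨(S ×ˢ Finset.range p).image (fun q => q.1 + (gL p - 1) ^ (j + 1) * (q.2 : L p)), ?_, ?_⟩
    · refine Finset.card_image_le.trans ?_
      rw [Finset.card_product, Finset.card_range, add_right_comm, pow_succ]
      exact Nat.mul_le_mul_right _ hS
    · intro l
      obtain ⟨u, hu, m, hm⟩ := h l
      obtain ⟨c, m', rfl⟩ := aux_aug p m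
      obtain ⟨k, hk, d, rfl⟩ := aux_div p 1 c
      refine ⟨u + (gL p - 1) ^ (j + 1) * (k : L p),
        Finset.mem_image.2 ⟨(u, k), Finset.mem_product.2 ⟨hu, Finset.mem_range.2 (by simpa using hk)⟩,
          rfl⟩, m' + e * (gL p - 1) ^ (p - 2) * algebraMap _ _ d, ?_⟩
      convert hm using 1
      have hpx := aux_px p e he
      have h2 : (gL p - 1) ^ p = (gL p - 1) ^ (p - 2) * (gL p - 1) ^ 2 := by
        rw [← pow_add, Nat.sub_add_cancel (Fact.out : p.Prime).two_le]
      rw [h2] at hpx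
      simp only [map_add, map_mul, map_pow, map_natCast]
      linear_combination (gL p - 1) ^ j * (algebraMap (PadicInt p) (L p) d) * hpx

theorem aux_card (p : ℕ) [Fact p.Prime] (A : Type) [AddCommGroup A] [Module (L p) A] [Finite A] :
    Nat.card A = Nat.card (commSub p A) * Nat.card (fixedSub p A) := by
  rw [Submodule.card_eq_card_quotient_mul_card (fixedSub p A), mul_comm]
  congr 1
  exact Nat.card_congr (LinearMap.quotKerEquivRange (LinearMap.lsmul (L p) A (gL p - 1))).toEquiv

theorem aux_nil (p : ℕ) [Fact p.Prime] (A : Type) [AddCommGroup A] [Module (L p) A] [Finite A]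
    (n : ℕ) (h : Nat.card A = p ^ n) (a : A) : (gL p - 1) ^ (p * n) • a = 0 := by
  obtain ⟨u, hu⟩ := aux_xp p
  rw [pow_mul, hu, mul_pow, mul_comm, mul_smul]
  have : (p : L p) ^ n • a = 0 := by
    rw [← Nat.cast_pow, ← h, Nat.cast_smul_eq_nsmul]
    exact card_nsmul_eq_zero'
  rw [this, smul_zero]

theorem aux_chain (p : ℕ) [Fact p.Prime] (A : Type) [AddCommGroup A] [Module (L p) A] [Finite A]
    (n r : ℕ) (h : Nat.card A = p ^ n) (hr : Nat.card (commSub p A) = p ^ r) (k : ℕ) :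
    Nat.card (LinearMap.range (LinearMap.lsmul (L p) A ((gL p - 1) ^ (k + 1)))) ∣ p ^ (r - k) := by
  induction k with
  | zero =>
    have : LinearMap.range (LinearMap.lsmul (L p) A ((gL p - 1) ^ (0 + 1))) = commSub p A := by
      simp [commSub]
    rw [this, hr]; simp
  | succ k ih =>
    set M := LinearMap.range (LinearMap.lsmul (L p) A ((gL p - 1) ^ (k + 1))) with hM
    set M' := LinearMap.range (LinearMap.lsmul (L p) A ((gL p - 1) ^ (k + 1 + 1))) with hM'
    have hle : M' ≤ M := by
      rintro _ ⟨a, rfl⟩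
      exact ⟨(gL p - 1) • a, by
        rw [LinearMap.lsmul_apply, LinearMap.lsmul_apply, ← mul_smul, ← pow_succ]⟩
    have hdvd : Nat.card M' ∣ Nat.card M :=
      AddSubgroup.card_dvd_of_le (H := M'.toAddSubgroup) (K := M.toAddSubgroup) hle
    by_cases heq : M' = M
    · have hk : ∀ i : ℕ, ∀ y ∈ M, ∃ a : A, y = (gL p - 1) ^ i • a := by
        intro i
        induction i with
        | zero => intro y _; exact ⟨y, by simp⟩
        | succ i ihi =>
          intro y hy
          rw [← heq] at hy
          obtain ⟨a, rfl⟩ := hy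
          obtain ⟨b, hb⟩ := ihi ((gL p - 1) ^ (k + 1) • a) ⟨a, rfl⟩
          refine ⟨b, ?_⟩
          rw [LinearMap.lsmul_apply, pow_succ' _ i, mul_smul, ← hb, ← mul_smul, ← pow_succ']
      have : M = ⊥ := by
        rw [eq_bot_iff]
        intro y hy
        obtain ⟨a, rfl⟩ := hk (p * n) y hy
        simp [aux_nil p A n h a]
      rw [heq, this]; simp
    · have hne : Nat.card M' ≠ Nat.card M := by
        intro hc
        apply heq
        apply SetLike.coe_injective
        exact Set.eq_of_subset_of_ncard_le hle (by
          rw [← Nat.card_coe_set_eq, ← Nat.card_coe_set_eq]; exact hc.ge) (Set.toFinite _)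
      obtain ⟨i, hi, hi2⟩ := (Nat.dvd_prime_pow (Fact.out : p.Prime)).1 ih
      rw [hi2] at hdvd hne
      obtain ⟨i', hi', hi2'⟩ := (Nat.dvd_prime_pow (Fact.out : p.Prime)).1 hdvd
      rw [hi2'] at hne ⊢
      have : i' ≠ i := fun h => hne (by rw [h])
      exact pow_dvd_pow _ (by omega)



/-- if `A` is a finite rank-1 `ℤ_p[G]`-module with invariants `r, s ≥ 1` and
`t ∈ {0,…,p−1}` (w.r.t. the norm-lift `e`), then the kernel of any surjective `L`-module
map `φ : L → A` is the submodule generated by `(g−1)^(r+1)` and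
`p^s·1 − e^s(g−1)^(s(p−1)) − t(g−1)^r`. -/
theorem stmt_4 (p : ℕ) [Fact p.Prime] (e : L p) (he : IsNormLift p e)
    (A : Type) [AddCommGroup A] [Module (L p) A] [Finite A]
    (hA : IsRankOne p A) (r s : ℕ) (hr : 1 ≤ r) (hs : 1 ≤ s)
    (hcard_r : Nat.card (commSub p A) = p ^ r)
    (hcard_s : Nat.card (fixedSub p A) = p ^ s)
    (t : ℕ) (htp : t < p)
    (ht : ∀ a : A, Submodule.span (L p) {a} = ⊤ →
      (p : L p) ^ s • a
        = (e ^ s * (gL p - 1) ^ (s * (p - 1))) • a + ((t : L p) * (gL p - 1) ^ r) • a)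
    (φ : L p →ₗ[L p] A) (hφ : Function.Surjective φ) :
    LinearMap.ker φ
      = Submodule.span (L p)
          {(gL p - 1) ^ (r + 1),
           (p : L p) ^ s - e ^ s * (gL p - 1) ^ (s * (p - 1)) - (t : L p) * (gL p - 1) ^ r} := by
  classical
  have hcard : Nat.card A = p ^ (r + s) := by
    rw [aux_card p A, hcard_r, hcard_s, pow_add]
  set J := Submodule.span (L p)
          {(gL p - 1) ^ (r + 1),
           (p : L p) ^ s - e ^ s * (gL p - 1) ^ (s * (p - 1)) - (t : L p) * (gL p - 1) ^ r} with hJ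
  have hφ1 : ∀ l : L p, φ l = l • φ 1 := by
    intro l
    rw [← map_smul, smul_eq_mul, mul_one]
  have hgen : Submodule.span (L p) {φ 1} = ⊤ := by
    rw [eq_top_iff]
    intro y _
    obtain ⟨l, rfl⟩ := hφ y
    rw [hφ1 l]
    exact Submodule.smul_mem _ l (Submodule.mem_span_singleton_self (φ 1))
  have hJle : J ≤ LinearMap.ker φ := by
    rw [hJ, Submodule.span_le]
    rintro y (rfl | rfl)
    · have hc := aux_chain p A (r + s) r hcard hcard_r r
      rw [Nat.sub_self, pow_zero, Nat.dvd_one, Nat.card_eq_one_iff_unique] at hc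
      have := hc.1
      have h1 := Subsingleton.elim
        (⟨(gL p - 1) ^ (r + 1) • φ 1, ⟨φ 1, rfl⟩⟩ :
          LinearMap.range (LinearMap.lsmul (L p) A ((gL p - 1) ^ (r + 1)))) 0
      have h2 := congrArg Subtype.val h1
      rw [SetLike.mem_coe, LinearMap.mem_ker, hφ1]
      exact h2
    · rw [SetLike.mem_coe, LinearMap.mem_ker, hφ1, sub_smul, sub_smul, ht _ hgen]
      abel
  refine le_antisymm ?_ hJle
  obtain ⟨S, hS, hSJ⟩ := aux_set p e he J s
    (e ^ s * (gL p - 1) ^ (s * (p - 1) - 1) + (t : L p) * (gL p - 1) ^ (r - 1)) (by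
      have h2 : 1 ≤ s * (p - 1) :=
        Nat.mul_pos hs (Nat.sub_pos_of_lt (Fact.out : p.Prime).one_lt)
      have h3 : (p : L p) ^ s - e ^ s * (gL p - 1) ^ (s * (p - 1)) - (t : L p) * (gL p - 1) ^ r
          ∈ J := Submodule.subset_span (Or.inr rfl)
      convert h3 using 1
      obtain ⟨a, ha⟩ := Nat.exists_eq_add_of_le h2
      obtain ⟨b, hb⟩ := Nat.exists_eq_add_of_le hr
      rw [ha, hb, Nat.add_sub_cancel_left, Nat.add_sub_cancel_left]
      ring) r
  have hSJ' : ∀ l : L p, ∃ u ∈ S, l - u ∈ J := by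
    intro l
    obtain ⟨u, hu, m, hm⟩ := hSJ l
    refine ⟨u, hu, ?_⟩
    have h4 : (gL p - 1) ^ (r + 1) ∈ J := Submodule.subset_span (Or.inl rfl)
    have := J.add_mem hm (J.smul_mem m h4)
    rw [smul_eq_mul, mul_comm m, sub_add_cancel] at this
    exact this
  have hφu : ∀ l u : L p, l - u ∈ J → φ l = φ u := by
    intro l u h
    have := hJle h
    rw [LinearMap.mem_ker, map_sub, sub_eq_zero] at this
    exact this
  have := Fintype.ofFinite A
  have himg : S.image φ = Finset.univ := by
    rw [Finset.eq_univ_iff_forall]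
    intro y
    obtain ⟨l, rfl⟩ := hφ y
    obtain ⟨u, hu, h⟩ := hSJ' l
    rw [hφu l u h]
    exact Finset.mem_image_of_mem _ hu
  have hinj : Set.InjOn φ S := by
    apply Finset.injOn_of_card_image_eq
    apply le_antisymm Finset.card_image_le
    rw [himg, Finset.card_univ, ← Nat.card_eq_fintype_card, hcard]
    exact hS
  intro f hf
  rw [LinearMap.mem_ker] at hf
  obtain ⟨u, hu, h⟩ := hSJ' f
  obtain ⟨u0, hu0, h0⟩ := hSJ' 0
  have : u = u0 := hinj hu hu0 (by rw [← hφu _ _ h, ← hφu _ _ h0, hf, map_zero])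
  subst this
  have := J.sub_mem h h0
  simpa using this
end
end

section
/- For every integer n ≥ 2, the number of L-submodules M ⊆ L with |L/M| = p^n that are free as L-modules equals (p−1)(n−1); for n = 1 this number is 0, and for n = 0 it is 1. -/
noncomputable section

section aux

variable (p : ℕ) [Fact p.Prime]

def eps : L p →ₐ[PadicInt p] PadicInt p :=
  MonoidAlgebra.lift (PadicInt p) (PadicInt p) (Multiplicative (ZMod p)) 1

abbrev CC : PadicInt p →+* L p := algebraMap (PadicInt p) (L p)

def TL : L p := gL p - 1

lemma eps_C (a : PadicInt p) : eps p (CC p a) = a := by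
  simpa using (eps p).commutes a

lemma eps_g : eps p (gL p) = 1 := by
  simp [eps, gL]

lemma eps_T : eps p (TL p) = 0 := by
  simp [TL, eps_g]

lemma eps_N : eps p (NL p) = p := by
  simp [NL, eps_g]

lemma g_pow (k : ℕ) : gL p ^ k = MonoidAlgebra.of (PadicInt p) (Multiplicative (ZMod p)) (Multiplicative.ofAdd (k : ZMod p)) := by
  rw [gL, ← map_pow, ← ofAdd_nsmul]; simp

lemma T_mul_N : TL p * NL p = 0 := by
  rw [TL, NL, mul_geom_sum, g_pow]
  simp [MonoidAlgebra.one_def]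

lemma sub_eps (x : L p) : ∃ y, x - CC p (eps p x) = TL p * y := by
  change TL p ∣ _
  induction x using MonoidAlgebra.induction_on with
  | of m =>
    have hm : MonoidAlgebra.of (PadicInt p) (Multiplicative (ZMod p)) m = gL p ^ (m.toAdd.val) := by
      rw [g_pow]; simp
    rw [hm, map_pow, eps_g, one_pow, map_one]
    exact sub_one_dvd_pow_sub_one _ _
  | add x y hx hy =>
    rw [map_add, map_add, add_sub_add_comm]
    exact dvd_add hx hy
  | smul r x hx =>
    rw [map_smul, smul_eq_mul, map_mul, Algebra.smul_def, ← mul_sub]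
    exact hx.mul_left _

lemma mul_N (x : L p) : x * NL p = CC p (eps p x) * NL p := by
  obtain ⟨y, hy⟩ := sub_eps p x
  linear_combination NL p * hy + y * T_mul_N p

lemma CN_coeff (a : PadicInt p) (m) : (CC p a * NL p).coeff m = a := by
  rw [← Algebra.smul_def, MonoidAlgebra.coeff_smul_apply, smul_eq_mul]
  have : (NL p).coeff m = 1 := by
    rw [NL, Finset.sum_congr rfl (fun i _ => g_pow p i)]
    simp only [MonoidAlgebra.coeff_sum, MonoidAlgebra.of_apply, Finsupp.finsetSum_apply,
      MonoidAlgebra.coeff_single, Finsupp.single_apply]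
    rw [Finset.sum_eq_single m.toAdd.val]
    · simp
    · intro b hb hne
      rw [if_neg]
      rintro rfl
      apply hne
      simp [ZMod.val_natCast, Nat.mod_eq_of_lt (Finset.mem_range.1 hb)]
    · intro h
      exact absurd (Finset.mem_range.2 (ZMod.val_lt _)) h
  rw [this, mul_one]

lemma T_ker (y : L p) (h : TL p * y = 0) : ∃ a, y = CC p a * NL p := by
  have h1 : gL p * y = y := by
    rw [TL] at h; linear_combination h
  have h2 : ∀ k : ℕ, gL p ^ k * y = y := by
    intro k
    induction k with
    | zero => simp
    | succ k ih => rw [pow_succ, mul_assoc, h1, ih]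
  refine ⟨y.coeff 1, ?_⟩
  apply MonoidAlgebra.coeff_injective
  ext m : 1
  rw [CN_coeff]
  have := h2 (m.toAdd.val)
  rw [g_pow] at this
  conv_lhs => rw [← this]
  simp

lemma p_ne : (p : PadicInt p) ≠ 0 := by
  exact_mod_cast (Fact.out : p.Prime).ne_zero

lemma CN_zero (a : PadicInt p) (h : CC p a * NL p = 0) : a = 0 := by
  have := CN_coeff p a 1
  rw [h] at this
  simpa using this.symm

lemma T_ker' (y z : L p) (h : TL p * y = z * NL p) : ∃ a, y = CC p a * NL p := by
  apply T_ker
  have := congrArg (eps p) h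
  rw [map_mul, map_mul, eps_T, eps_N, zero_mul] at this
  have h0 : eps p z = 0 := by
    rcases mul_eq_zero.1 this.symm with h | h
    · exact h
    · exact absurd h (p_ne p)
  rw [h, mul_N, h0]; simp

lemma Tpow_ker' (j : ℕ) (y z : L p) (h : TL p ^ j * y = z * NL p) : ∃ a, y = CC p a * NL p := by
  induction j generalizing y z with
  | zero => exact ⟨eps p z, by rw [← mul_N, ← h]; simp⟩
  | succ j ih =>
    rw [pow_succ, mul_assoc] at h
    obtain ⟨a, ha⟩ := ih _ _ h
    exact T_ker' p _ _ ha

lemma isUnit_of_eps (x : L p) (h : IsUnit (eps p x)) : IsUnit x := by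
  by_contra hx
  obtain ⟨m, hm, hxm⟩ := exists_max_ideal_of_mem_nonunits hx
  have hmm : (m.comap (CC p)).IsMaximal := Ideal.isMaximal_comap_of_isIntegral_of_isMaximal m
  have hp : (p : L p) ∈ m := by
    have h1 := IsLocalRing.eq_maximalIdeal hmm
    have h2 : (p : PadicInt p) ∈ m.comap (CC p) := by
      rw [h1, PadicInt.maximalIdeal_eq_span_p]
      exact Ideal.mem_span_singleton_self _
    simpa using h2
  have hT : TL p ∈ m := by
    apply hm.isPrime.mem_of_pow_mem p
    obtain ⟨r, hr⟩ := exists_add_pow_prime_eq (Fact.out : p.Prime) (TL p) (1 : L p)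
    have hg : gL p ^ p = 1 := by rw [g_pow]; simp [MonoidAlgebra.one_def]
    have : TL p ^ p = - (p * (TL p * 1 * r)) := by
      have e : TL p + 1 = gL p := by simp [TL]
      rw [e, hg, one_pow] at hr
      linear_combination -hr
    rw [this]
    exact m.neg_mem (m.mul_mem_right _ hp)
  obtain ⟨y, hy⟩ := sub_eps p x
  have : CC p (eps p x) ∈ m := by
    have : CC p (eps p x) = x - TL p * y := by rw [← hy]; ring
    rw [this]
    exact m.sub_mem hxm (m.mul_mem_right _ hT)
  exact hm.ne_top (Ideal.eq_top_of_isUnit_mem _ this (h.map _))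

lemma mem_of_not_unit (x : L p) (h : ¬ IsUnit x) : ∃ y z, x = TL p * y + z * NL p := by
  have h1 : ¬ IsUnit (eps p x) := fun h' => h (isUnit_of_eps p x h')
  have h2 : eps p x ∈ IsLocalRing.maximalIdeal (PadicInt p) := h1
  rw [PadicInt.maximalIdeal_eq_span_p, Ideal.mem_span_singleton] at h2
  obtain ⟨b, hb⟩ := h2
  obtain ⟨y, hy⟩ := sub_eps p x
  obtain ⟨y', hy'⟩ := sub_eps p (NL p)
  rw [hb] at hy
  rw [eps_N] at hy'
  rw [map_mul] at hy
  exact ⟨y - CC p b * y', CC p b, by linear_combination hy - CC p b * hy'⟩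

def idx {R : Type*} [CommRing R] (x : R) : ℕ := (AddMonoidHom.mulLeft x).range.index

lemma idx_mul {R : Type*} [CommRing R] (x y : R) (hx : Function.Injective (x * ·)) :
    idx (x * y) = idx y * idx x := by
  rw [idx, idx, idx, ← AddSubgroup.index_map_of_injective _ (f := AddMonoidHom.mulLeft x) hx,
    AddMonoidHom.map_range]
  congr 2
  ext z
  simp [mul_assoc]

lemma idx_unit {R : Type*} [CommRing R] (x : R) (hx : IsUnit x) : idx x = 1 := by
  rw [idx, AddSubgroup.index_eq_one, AddMonoidHom.range_eq_top]
  intro y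
  obtain ⟨u, rfl⟩ := hx
  exact ⟨↑u⁻¹ * y, by simp⟩

lemma idx_pow {R : Type*} [CommRing R] (x : R) (hx : Function.Injective (x * ·)) (k : ℕ) :
    idx (x ^ k) = idx x ^ k := by
  induction k with
  | zero => simpa using idx_unit (1 : R) isUnit_one
  | succ k ih => rw [pow_succ', idx_mul _ _ hx, ih, pow_succ]

lemma card_quot {R : Type*} [CommRing R] (x : R) :
    Nat.card (R ⧸ Submodule.span R {x}) = idx x := by
  have : (AddMonoidHom.mulLeft x).range = (Submodule.span R {x}).toAddSubgroup := by
    ext z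
    simp [Submodule.mem_span_singleton, mul_comm]
  rw [idx, this]
  rfl

lemma idx_prod {R S : Type*} [CommRing R] [CommRing S] (x : R) (y : S) :
    idx (x, y) = idx x * idx y := by
  rw [idx, idx, idx, ← AddSubgroup.index_prod]
  congr 1
  ext ⟨a, b⟩
  simp [AddSubgroup.mem_prod]

abbrev SS := L p ⧸ Ideal.span {NL p}

abbrev mkS : L p →+* SS p := Ideal.Quotient.mk _

lemma mkS_zero (x : L p) : mkS p x = 0 ↔ ∃ a, x = CC p a * NL p := by
  rw [Ideal.Quotient.eq_zero_iff_mem, Ideal.mem_span_singleton]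
  constructor
  · rintro ⟨z, rfl⟩
    exact ⟨_, (mul_comm _ _).trans (mul_N p z)⟩
  · rintro ⟨a, rfl⟩
    exact Dvd.intro_left _ rfl

lemma mkS_N : mkS p (NL p) = 0 := (mkS_zero p _).2 ⟨1, by rw [map_one, one_mul]⟩

lemma pi_inj (j : ℕ) : Function.Injective (mkS p (TL p) ^ j * ·) := by
  have : Function.Injective (AddMonoidHom.mulLeft (mkS p (TL p) ^ j)) := by
    rw [injective_iff_map_eq_zero]
    intro y hy
    obtain ⟨y, rfl⟩ := Ideal.Quotient.mk_surjective y
    rw [AddMonoidHom.coe_mulLeft, ← map_pow, ← map_mul, mkS_zero] at hy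
    obtain ⟨a, ha⟩ := hy
    exact (mkS_zero p y).2 (Tpow_ker' p j _ _ ha)
  exact this

lemma toZMod_surj : Function.Surjective (PadicInt.toZMod (p := p)) :=
  ZMod.ringHom_surjective _

lemma toZMod_zero (a : PadicInt p) : PadicInt.toZMod a = 0 ↔ ∃ b, a = p * b := by
  rw [← RingHom.mem_ker, PadicInt.ker_toZMod, PadicInt.maximalIdeal_eq_span_p,
    Ideal.mem_span_singleton]
  rfl

lemma idx_p : idx (p : PadicInt p) = p := by
  have : (AddMonoidHom.mulLeft (p : PadicInt p)).range
      = (PadicInt.toZMod (p := p)).toAddMonoidHom.ker := by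
    ext a
    rw [AddMonoidHom.mem_ker]
    change _ ↔ PadicInt.toZMod a = 0
    rw [toZMod_zero]
    simp [eq_comm]
  rw [idx, this, AddSubgroup.index_ker, AddMonoidHom.range_eq_top.2 (toZMod_surj p)]
  simp

lemma idx_pi : idx (mkS p (TL p)) = p := by
  let f : L p →+* ZMod p := (PadicInt.toZMod (p := p)).comp (eps p).toRingHom
  have hf : Function.Surjective f := ZMod.ringHom_surjective _
  have : ((AddMonoidHom.mulLeft (mkS p (TL p))).range).comap (mkS p).toAddMonoidHom
      = f.toAddMonoidHom.ker := by
    ext x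
    rw [AddMonoidHom.mem_ker]
    change (∃ y, mkS p (TL p) * y = mkS p x) ↔ PadicInt.toZMod (eps p x) = 0
    rw [toZMod_zero]
    constructor
    · rintro ⟨y, hy⟩
      obtain ⟨y, rfl⟩ := Ideal.Quotient.mk_surjective y
      rw [← sub_eq_zero, ← map_mul, ← map_sub, mkS_zero] at hy
      obtain ⟨a, ha⟩ := hy
      have := congrArg (eps p) ha
      rw [map_sub, map_mul, map_mul, eps_T, eps_N, eps_C] at this
      exact ⟨-a, by linear_combination -this⟩
    · rintro ⟨b, hb⟩
      obtain ⟨y, z, h⟩ := mem_of_not_unit p x (by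
        intro hx
        have h1 := hx.map (eps p)
        rw [hb] at h1
        exact PadicInt.p_nonunit (isUnit_of_mul_isUnit_left h1))
      refine ⟨mkS p y, ?_⟩
      rw [h, map_add, map_mul, map_mul, mkS_N]; simp
  rw [idx, ← AddSubgroup.index_comap_of_surjective _ (f := (mkS p).toAddMonoidHom) Ideal.Quotient.mk_surjective,
    this, AddSubgroup.index_ker, AddMonoidHom.range_eq_top.2 hf]
  simp

lemma p_inj (a : PadicInt p) (ha : a ≠ 0) : Function.Injective (a * ·) :=
  mul_right_injective₀ ha

lemma idx_p_pow (i : ℕ) : idx ((p : PadicInt p) ^ i) = p ^ i := by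
  rw [idx_pow _ (p_inj p _ (p_ne p)), idx_p]

lemma idx_pi_pow (i : ℕ) : idx (mkS p (TL p) ^ i) = p ^ i := by
  rw [idx_pow _ (by simpa using pi_inj p 1), idx_pi]

def phi : L p →+* PadicInt p × SS p := (eps p).toRingHom.prod (mkS p)

lemma phi_apply (x : L p) : phi p x = (eps p x, mkS p x) := rfl

lemma phi_inj : Function.Injective (phi p) := by
  rw [injective_iff_map_eq_zero]
  intro x hx
  rw [phi_apply, Prod.mk_eq_zero, mkS_zero] at hx
  obtain ⟨h1, a, rfl⟩ := hx
  rw [map_mul, eps_C, eps_N, mul_eq_zero] at h1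
  rcases h1 with h | h
  · simp [h]
  · exact absurd h (p_ne p)

lemma phi_index : (phi p).toAddMonoidHom.range.index ≠ 0 := by
  have h : (AddMonoidHom.mulLeft ((p : PadicInt p), mkS p (TL p))).range ≤
      (phi p).toAddMonoidHom.range := by
    rintro _ ⟨⟨a, b⟩, rfl⟩
    obtain ⟨b, rfl⟩ := Ideal.Quotient.mk_surjective b
    refine ⟨CC p a * NL p + TL p * b, ?_⟩
    change phi p _ = _
    rw [phi_apply]
    ext
    · simp only [map_add, map_mul, eps_C, eps_N, eps_T]; simp [mul_comm]
    · simp only [map_add, map_mul, mkS_N]; simp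
  have h2 := AddSubgroup.index_dvd_of_le h
  have h3 : (AddMonoidHom.mulLeft ((p : PadicInt p), mkS p (TL p))).range.index = p * p := by
    have := idx_prod (p : PadicInt p) (mkS p (TL p))
    rw [idx_p, idx_pi] at this
    exact this
  intro h0
  rw [h0, h3] at h2
  have := (Fact.out : p.Prime).pos
  have := Nat.eq_zero_of_zero_dvd h2
  nlinarith

lemma idx_main (x : L p) (h1 : eps p x ≠ 0) (h2 : Function.Injective (mkS p x * ·)) :
    idx x = idx (eps p x) * idx (mkS p x) := by
  have e1 := AddSubgroup.index_map_of_injective (AddMonoidHom.mulLeft x).range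
    (f := (phi p).toAddMonoidHom) (phi_inj p)
  have e2 := AddSubgroup.index_map_of_injective (phi p).toAddMonoidHom.range
    (f := AddMonoidHom.mulLeft (phi p x)) (by
      rintro ⟨a, b⟩ ⟨c, d⟩ h
      rw [phi_apply] at h
      simp only [AddMonoidHom.coe_mulLeft, Prod.mk_mul_mk, Prod.mk.injEq] at h
      exact Prod.ext (p_inj p _ h1 h.1) (h2 h.2))
  have e3 : (AddMonoidHom.mulLeft x).range.map (phi p).toAddMonoidHom =
      (phi p).toAddMonoidHom.range.map (AddMonoidHom.mulLeft (phi p x)) := by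
    rw [AddMonoidHom.map_range, AddMonoidHom.map_range]
    congr 1
    refine AddMonoidHom.ext fun y => ?_
    change phi p (x * y) = phi p x * phi p y
    rw [map_mul]
  rw [e3, e2] at e1
  have e4 : (AddMonoidHom.mulLeft (phi p x)).range.index = idx (eps p x) * idx (mkS p x) := by
    rw [← idx_prod]; rfl
  rw [e4, mul_comm] at e1
  exact (Nat.eq_of_mul_eq_mul_right (Nat.pos_of_ne_zero (phi_index p)) e1).symm

def XX (i j : ℕ) (c : PadicInt p) : L p := TL p ^ j + CC p (c * (p : PadicInt p) ^ i) * NL p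

lemma eps_XX (i j : ℕ) (c : PadicInt p) (hj : j ≠ 0) : eps p (XX p i j c) = c * (p : PadicInt p) ^ (i + 1) := by
  rw [XX, map_add, map_pow, eps_T, map_mul, eps_C, eps_N, zero_pow hj]
  ring

lemma mk_XX (i j : ℕ) (c : PadicInt p) : mkS p (XX p i j c) = mkS p (TL p) ^ j := by
  rw [XX, map_add, map_mul, mkS_N, map_pow, mul_zero, add_zero]

lemma eps_XX_ne (i j : ℕ) (c : PadicInt p) (hj : j ≠ 0) (hc : IsUnit c) : eps p (XX p i j c) ≠ 0 := by
  rw [eps_XX p i j c hj]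
  exact mul_ne_zero hc.ne_zero (pow_ne_zero _ (p_ne p))

lemma idx_XX (i j : ℕ) (c : PadicInt p) (hj : j ≠ 0) (hc : IsUnit c) :
    idx (XX p i j c) = p ^ (i + 1 + j) := by
  rw [idx_main p _ (eps_XX_ne p i j c hj hc) (by rw [mk_XX]; exact pi_inj p j), mk_XX,
    eps_XX p i j c hj, idx_mul _ _ (p_inj p _ hc.ne_zero), idx_unit c hc, idx_p_pow, idx_pi_pow,
    mul_one, pow_add p (i + 1)]

lemma XX_free (i j : ℕ) (c : PadicInt p) (hj : j ≠ 0) (hc : IsUnit c) :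
    Module.Free (L p) (Submodule.span (L p) {XX p i j c}) := by
  have hinj : Function.Injective (LinearMap.toSpanSingleton (L p) (L p) (XX p i j c)) := by
    intro y z h
    simp only [LinearMap.toSpanSingleton_apply, smul_eq_mul] at h
    apply phi_inj p
    have h' := congrArg (phi p) h
    rw [map_mul, map_mul, phi_apply, phi_apply, phi_apply, Prod.mk_mul_mk, Prod.mk_mul_mk,
      Prod.mk.injEq, mk_XX] at h'
    exact Prod.ext (p_inj p _ (eps_XX_ne p i j c hj hc)
      ((mul_comm _ _).trans (h'.1.trans (mul_comm _ _))))
      (pi_inj p j ((mul_comm _ _).trans (h'.2.trans (mul_comm _ _))))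
  rw [LinearMap.span_singleton_eq_range]
  exact Module.Free.of_equiv (LinearEquiv.ofInjective _ hinj)

lemma XX_inj (i j i' j' : ℕ) (c c' : PadicInt p) (hj : j ≠ 0) (hj' : j' ≠ 0) (hc : IsUnit c)
    (hc' : IsUnit c') (h : Submodule.span (L p) {XX p i j c} = Submodule.span (L p) {XX p i' j' c'}) :
    i = i' ∧ j = j' ∧ PadicInt.toZMod c = PadicInt.toZMod c' := by
  have hp1 := (Fact.out : p.Prime).one_lt
  have m1 : XX p i j c ∈ Submodule.span (L p) {XX p i' j' c'} := by
    rw [← h]; exact Submodule.mem_span_singleton_self _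
  have m2 : XX p i' j' c' ∈ Submodule.span (L p) {XX p i j c} := by
    rw [h]; exact Submodule.mem_span_singleton_self _
  rw [Submodule.mem_span_singleton] at m1 m2
  obtain ⟨u, hu⟩ := m1
  obtain ⟨v, hv⟩ := m2
  rw [smul_eq_mul] at hu hv
  have key : ∀ (i j i' j' : ℕ) (c c' : PadicInt p) (u : L p) (_ : j ≠ 0) (_ : j' ≠ 0) (_ : IsUnit c)
      (_ : u * XX p i' j' c' = XX p i j c), i' ≤ i ∧ j' ≤ j := by
    intro i j i' j' c c' u hj hj' hc hu
    constructor
    · have h1 := congrArg (eps p) hu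
      rw [map_mul, eps_XX _ _ _ _ hj, eps_XX _ _ _ _ hj'] at h1
      have h2 : (p : PadicInt p) ^ (i' + 1) ∣ p ^ (i + 1) := by
        rw [← hc.dvd_mul_left, ← h1]
        exact Dvd.intro_left _ (mul_assoc _ _ _)
      have := (pow_dvd_pow_iff (p_ne p) PadicInt.p_nonunit).1 h2
      omega
    · have h1 := congrArg (mkS p) hu
      rw [map_mul, mk_XX, mk_XX] at h1
      have h2 : (AddMonoidHom.mulLeft (mkS p (TL p) ^ j)).range ≤
        (AddMonoidHom.mulLeft (mkS p (TL p) ^ j')).range := by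
        rintro _ ⟨y, rfl⟩
        refine ⟨mkS p u * y, ?_⟩
        simp only [AddMonoidHom.coe_mulLeft]
        rw [← h1]; ring
      have h3 : idx (mkS p (TL p) ^ j') ∣ idx (mkS p (TL p) ^ j) := AddSubgroup.index_dvd_of_le h2
      rw [idx_pi_pow, idx_pi_pow] at h3
      exact (Nat.pow_dvd_pow_iff_le_right hp1).1 h3
  have k1 := key _ _ _ _ _ _ _ hj hj' hc hu
  have k2 := key _ _ _ _ _ _ _ hj' hj hc' hv
  obtain rfl : i = i' := le_antisymm k2.1 k1.1
  obtain rfl : j = j' := le_antisymm k2.2 k1.2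
  refine ⟨rfl, rfl, ?_⟩
  have e1 := congrArg (eps p) hu
  rw [map_mul, eps_XX _ _ _ _ hj, eps_XX _ _ _ _ hj, ← mul_assoc] at e1
  have e2 := mul_right_cancel₀ (pow_ne_zero _ (p_ne p)) e1
  have e3 := congrArg (mkS p) hu
  rw [map_mul, mk_XX, mk_XX] at e3
  have e4 : mkS p u = mkS p 1 := by
    apply pi_inj p j
    simp only
    rw [mul_comm, e3, map_one, mul_one]
  rw [← sub_eq_zero, ← map_sub, mkS_zero] at e4
  obtain ⟨a, ha⟩ := e4
  have e5 := congrArg (eps p) ha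
  rw [map_sub, map_one, map_mul, eps_C, eps_N] at e5
  have e6 : eps p u = 1 + a * p := by linear_combination e5
  rw [← e2, e6]
  simp

lemma dichot (k : ℕ) (x : L p) :
    (∃ j < k, ∃ u : L p, IsUnit u ∧ ∃ z, x = u * TL p ^ j + z * NL p) ∨
    ∃ y z, x = TL p ^ k * y + z * NL p := by
  induction k with
  | zero => exact Or.inr ⟨x, 0, by simp⟩
  | succ k ih =>
    rcases ih with ⟨j, hj, h⟩ | ⟨y, z, h⟩
    · exact Or.inl ⟨j, by omega, h⟩
    · by_cases hy : IsUnit y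
      · exact Or.inl ⟨k, by omega, y, hy, z, by rw [h]; ring⟩
      · obtain ⟨a, b, hab⟩ := mem_of_not_unit p y hy
        exact Or.inr ⟨a, TL p ^ k * b + z, by rw [h, hab]; ring⟩

lemma form1 (n : ℕ) (x : L p) (hx : idx x = p ^ n) :
    ∃ j : ℕ, ∃ u : L p, IsUnit u ∧ ∃ z, x = u * TL p ^ j + z * NL p := by
  have hp1 := (Fact.out : p.Prime).one_lt
  rcases dichot p (n + 1) x with ⟨j, hj, h⟩ | ⟨y, z, h⟩
  · exact ⟨j, h⟩
  · exfalso
    have h1 : idx (mkS p x) ∣ idx x := by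
      have h2 := AddSubgroup.index_map_dvd (AddMonoidHom.mulLeft x).range
        (f := (mkS p).toAddMonoidHom) Ideal.Quotient.mk_surjective
      have h3 : (AddMonoidHom.mulLeft x).range.map (mkS p).toAddMonoidHom =
          (AddMonoidHom.mulLeft (mkS p x)).range := by
        ext y
        constructor
        · rintro ⟨_, ⟨y, rfl⟩, rfl⟩
          exact ⟨mkS p y, (map_mul (mkS p) x y).symm⟩
        · rintro ⟨y, rfl⟩
          obtain ⟨y, rfl⟩ := Ideal.Quotient.mk_surjective y
          exact ⟨_, ⟨y, rfl⟩, (map_mul (mkS p) x y)⟩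
      rw [h3] at h2
      exact h2
    have h4 : idx (mkS p (TL p) ^ (n + 1)) ∣ idx (mkS p x) := by
      apply AddSubgroup.index_dvd_of_le
      rintro _ ⟨w, rfl⟩
      refine ⟨mkS p y * w, ?_⟩
      simp only [AddMonoidHom.coe_mulLeft]
      rw [h, map_add, map_mul, map_mul, mkS_N, map_pow]
      ring
    have h5 := h4.trans h1
    rw [idx_pi_pow, hx] at h5
    have := (Nat.pow_dvd_pow_iff_le_right hp1).1 h5
    omega

lemma form2 (n : ℕ) (x : L p) (hx : idx x = p ^ n) :
    IsUnit x ∨ ∃ i j c : ℕ, j ≠ 0 ∧ 0 < c ∧ c < p ∧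
      Submodule.span (L p) {x} = Submodule.span (L p) {XX p i j c} := by
  obtain ⟨j, u, hu, z, h⟩ := form1 p n x hx
  have hpx : eps p x ≠ 0 := by
    intro h0
    have hd : (p ^ n : ℕ) • (1 : L p) ∈ Submodule.span (L p) {x} := by
      rw [← hx, ← card_quot x, ← Submodule.Quotient.mk_eq_zero, Submodule.Quotient.mk_smul]
      exact card_nsmul_eq_zero'
    obtain ⟨y, hy⟩ := Submodule.mem_span_singleton.1 hd
    have := congrArg (eps p) hy
    rw [smul_eq_mul, map_mul, h0, map_nsmul, map_one, mul_zero, nsmul_one] at this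
    have h2 : ((p ^ n : ℕ) : PadicInt p) ≠ 0 := by
      rw [Nat.cast_pow]; exact pow_ne_zero _ (p_ne p)
    exact h2 this.symm
  rcases eq_or_ne j 0 with rfl | hj
  · left
    by_contra hne
    obtain ⟨a, b, hab⟩ := mem_of_not_unit p x hne
    have h1 := congrArg (eps p) h
    have h2 := congrArg (eps p) hab
    rw [map_add, map_mul, map_mul, eps_N] at h1 h2
    rw [eps_T] at h2
    have h3 : eps p u = p * (eps p b - eps p z) := by
      rw [pow_zero, map_one] at h1
      linear_combination h2 - h1
    have h4 := hu.map (eps p)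
    rw [h3] at h4
    exact PadicInt.p_nonunit (isUnit_of_mul_isUnit_left h4)
  · right
    obtain ⟨u, rfl⟩ := hu
    -- x = u (T^j + a N)
    set a := eps p (↑u⁻¹ * z) with ha
    have hxa : x = u * (TL p ^ j + CC p a * NL p) := by
      rw [ha, ← mul_N, h, mul_add, mul_assoc, Units.mul_inv_cancel_left]
    have ha0 : a ≠ 0 := by
      intro h0
      apply hpx
      rw [hxa, h0, map_mul, map_add, map_pow, eps_T, zero_pow hj]; simp
    obtain ⟨i, v, hv⟩ : ∃ (i : ℕ) (v : (PadicInt p)ˣ), a = v * (p : PadicInt p) ^ i :=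
      ⟨_, _, PadicInt.unitCoeff_spec ha0⟩
    have hc0 : PadicInt.toZMod (v : PadicInt p) ≠ 0 := (v.isUnit.map PadicInt.toZMod).ne_zero
    set c := (PadicInt.toZMod (v : PadicInt p)).val with hc
    have hcpos : 0 < c := Nat.pos_of_ne_zero (by rwa [hc, Ne, ZMod.val_eq_zero])
    have hcp : c < p := ZMod.val_lt _
    refine ⟨i, j, c, hj, hcpos, hcp, ?_⟩
    have hcc : PadicInt.toZMod (c : PadicInt p) = PadicInt.toZMod (v : PadicInt p) := by
      rw [map_natCast, hc, ZMod.natCast_zmod_val]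
    -- w = 1 + b N, c = v (1 + p b)
    have hcb : ∃ b, (c : PadicInt p) = v * (1 + p * b) := by
      have : PadicInt.toZMod ((c : PadicInt p) - (v : PadicInt p)) = 0 := by rw [map_sub, hcc, sub_self]
      obtain ⟨b, hb⟩ := (toZMod_zero p _).1 this
      refine ⟨↑v⁻¹ * b, ?_⟩
      have e := v.mul_inv
      linear_combination hb - p * b * e
    obtain ⟨b, hb⟩ := hcb
    have hw : IsUnit (1 + CC p b * NL p) := by
      apply isUnit_of_eps
      rw [map_add, map_one, map_mul, eps_C, eps_N]
      have : IsUnit (c : PadicInt p) := by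
        by_contra hnu
        have h1 : (c : PadicInt p) ∈ IsLocalRing.maximalIdeal (PadicInt p) := hnu
        rw [← PadicInt.ker_toZMod, RingHom.mem_ker, hcc] at h1
        exact hc0 h1
      rw [hb] at this
      rw [mul_comm b]
      exact isUnit_of_mul_isUnit_right this
    have hN : NL p * NL p = CC p p * NL p := by rw [mul_N, eps_N]
    have hTj : TL p ^ j * NL p = 0 := by
      obtain ⟨k, rfl⟩ := Nat.exists_eq_succ_of_ne_zero hj
      rw [pow_succ, mul_assoc, T_mul_N, mul_zero]
    have hX : XX p i j c = (1 + CC p b * NL p) * (TL p ^ j + CC p a * NL p) := by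
      rw [XX, hb, hv]
      simp only [map_mul, map_add, map_one]
      linear_combination -CC p b * hTj - CC p b * CC p v * CC p ((p : PadicInt p) ^ i) * hN
    obtain ⟨w, hw⟩ := hw
    have hX' : XX p i j c = (w * u⁻¹ : (L p)ˣ) • x := by
      rw [hX, hxa, ← hw, Units.smul_def, smul_eq_mul, Units.val_mul, mul_assoc,
        Units.inv_mul_cancel_left]
    rw [hX', Submodule.span_singleton_group_smul_eq]

lemma free_principal (M : Submodule (L p) (L p)) (h : Module.Free (L p) M) :
    ∃ x, M = Submodule.span (L p) {x} := by
  obtain ⟨ι, b⟩ := h.exists_basis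
  have hs : Subsingleton ι := by
    constructor
    intro i j
    by_contra hij
    have h1 : (b j : L p) • b i - (b i : L p) • b j = 0 := by
      ext1
      simp [mul_comm]
    have h2 := congrArg (fun z => b.repr z j) h1
    have h3 := congrArg (fun z => b.repr z i) h1
    simp [hij, Ne.symm hij] at h2 h3
    exact b.ne_zero i h2
  rcases isEmpty_or_nonempty ι with he | ⟨⟨i⟩⟩
  · refine ⟨0, ?_⟩
    have : Subsingleton M := b.repr.toEquiv.subsingleton
    rw [Submodule.span_zero_singleton]
    exact Submodule.subsingleton_iff_eq_bot.1 this
  · refine ⟨b i, ?_⟩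
    have h1 := b.span_eq
    have h2 : Set.range b = {b i} := by
      ext y; simp only [Set.mem_range, Set.mem_singleton_iff]
      exact ⟨fun ⟨k, hk⟩ => by rw [← hk, Subsingleton.elim k i], fun h => ⟨i, h.symm⟩⟩
    rw [h2] at h1
    have h3 := congrArg (Submodule.map M.subtype) h1
    rw [Submodule.map_span, Submodule.map_top, Submodule.range_subtype] at h3
    simpa using h3.symm

lemma natCast_isUnit (c : ℕ) (h0 : 0 < c) (hc : c < p) : IsUnit (c : PadicInt p) := by
  by_contra hnu
  have h1 : (c : PadicInt p) ∈ IsLocalRing.maximalIdeal (PadicInt p) := hnu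
  rw [← PadicInt.ker_toZMod, RingHom.mem_ker, map_natCast, ZMod.natCast_eq_zero_iff] at h1
  exact absurd (Nat.le_of_dvd h0 h1) (by omega)

lemma classify (n : ℕ) (hn : n ≠ 0) (M : Submodule (L p) (L p))
    (h1 : Nat.card (L p ⧸ M) = p ^ n) (h2 : Module.Free (L p) M) :
    ∃ i j c : ℕ, j ≠ 0 ∧ 0 < c ∧ c < p ∧ i + 1 + j = n ∧
      M = Submodule.span (L p) {XX p i j c} := by
  have hp1 := (Fact.out : p.Prime).one_lt
  obtain ⟨x, rfl⟩ := free_principal p M h2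
  rw [card_quot] at h1
  rcases form2 p n x h1 with h | ⟨i, j, c, hj, h0, hc, h⟩
  · rw [idx_unit x h] at h1
    exact absurd h1.symm (Nat.one_lt_pow hn hp1).ne'
  · refine ⟨i, j, c, hj, h0, hc, ?_, h⟩
    rw [← card_quot, h, card_quot, idx_XX p i j c hj (natCast_isUnit p c h0 hc)] at h1
    exact Nat.pow_right_injective hp1 h1

def param (n : ℕ) (q : Fin (n - 1) × Fin (p - 1)) :
    {M : Submodule (L p) (L p) // Nat.card (L p ⧸ M) = p ^ n ∧ Module.Free (L p) M} :=
  ⟨Submodule.span (L p) {XX p q.1 (n - 1 - q.1) ((q.2.val + 1 : ℕ) : PadicInt p)}, by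
    have h1 := q.1.2
    have h2 := q.2.2
    have hu := natCast_isUnit p (q.2.val + 1) (by omega) (by omega)
    refine ⟨?_, XX_free p _ _ _ (by omega) hu⟩
    rw [card_quot, idx_XX p _ _ _ (by omega) hu]
    congr 1; omega⟩

lemma param_bij (n : ℕ) (hn : n ≠ 0) : Function.Bijective (param p n) := by
  constructor
  · rintro ⟨a, b⟩ ⟨a', b'⟩ h
    have h := congrArg Subtype.val h
    have h1 := a.2
    have h2 := b.2
    have h1' := a'.2
    have h2' := b'.2
    obtain ⟨e1, -, e3⟩ := XX_inj p _ _ _ _ _ _ (by simp only; omega) (by simp only; omega)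
      (natCast_isUnit p (b.val + 1) (by omega) (by omega))
      (natCast_isUnit p (b'.val + 1) (by omega) (by omega)) h
    rw [map_natCast, map_natCast, ZMod.natCast_eq_natCast_iff'] at e3
    rw [Nat.mod_eq_of_lt (by omega), Nat.mod_eq_of_lt (by omega)] at e3
    ext
    · exact e1
    · simpa using e3
  · rintro ⟨M, h1, h2⟩
    obtain ⟨i, j, c, hj, h0, hc, hij, hM⟩ := classify p n hn M h1 h2
    refine ⟨(⟨i, by omega⟩, ⟨c - 1, by omega⟩), ?_⟩
    apply Subtype.ext
    refine Eq.trans ?_ hM.symm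
    have e1 : n - 1 - i = j := by omega
    have e2 : c - 1 + 1 = c := by omega
    simp only [param, e1, e2]

end aux

/-- the number of `L`-submodules `M ⊆ L` with `|L/M| = p^n` that are free as
`L`-modules equals `(p−1)(n−1)` for `n ≥ 2`, equals `0` for `n = 1`, and `1` for `n = 0`. -/
theorem stmt_11 (p : ℕ) [Fact p.Prime] :
    (∀ n : ℕ, 2 ≤ n →
      Nat.card {M : Submodule (L p) (L p) //
          Nat.card (L p ⧸ M) = p ^ n ∧ Module.Free (L p) M}
        = (p - 1) * (n - 1)) ∧
    Nat.card {M : Submodule (L p) (L p) //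
        Nat.card (L p ⧸ M) = p ^ 1 ∧ Module.Free (L p) M} = 0 ∧
    Nat.card {M : Submodule (L p) (L p) //
        Nat.card (L p ⧸ M) = p ^ 0 ∧ Module.Free (L p) M} = 1 := by
  have H : ∀ n : ℕ, n ≠ 0 → Nat.card {M : Submodule (L p) (L p) //
          Nat.card (L p ⧸ M) = p ^ n ∧ Module.Free (L p) M}
        = (p - 1) * (n - 1) := by
    intro n hn
    rw [← Nat.card_congr (Equiv.ofBijective _ (param_bij p n hn))]
    simp [mul_comm]
  refine ⟨fun n hn => H n (by omega), by simpa using H 1 one_ne_zero, ?_⟩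
  rw [Nat.card_eq_one_iff_unique]
  refine ⟨⟨?_⟩, ⟨⟨⊤, ?_, ?_⟩⟩⟩
  · have key : ∀ M : Submodule (L p) (L p), Nat.card (L p ⧸ M) = p ^ 0 → M = ⊤ := by
      intro M h
      rw [pow_zero, Nat.card_eq_one_iff_unique] at h
      exact Submodule.Quotient.subsingleton_iff.1 h.1
    rintro ⟨M, h, _⟩ ⟨M', h', _⟩
    apply Subtype.ext
    exact (key M h).trans (key M' h').symm
  · rw [pow_zero, Nat.card_eq_one_iff_unique]
    exact ⟨Submodule.Quotient.subsingleton_iff.2 rfl, inferInstance⟩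
  · exact Module.Free.of_equiv Submodule.topEquiv.symm
end
end
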